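/- Let f ∈ F[x] be irreducible of degree d, e ≥ 1, A ∈ (F[x]/(f^e))^{b×b} with Smith normal form diag(f^0 repeated m_0 times, f^1 repeated m_1 times, ..., f^{e-1} repeated m_{e-1} times, 0 repeated m_e times). Then any minimal generator G of A (i.e., AG = 0, det G ≠ 0, deg det G minimal) has Smith normal form over F[x] equal to diag(1 repeated m_e times, f repeated m_{e-1} times, f^2 repeated m_{e-2} times, ..., f^e repeated m_0 times). -/

import Mathlib

open Polynomial Matrix

/-- `D` is a Smith normal form of `A`: `D` is obtained from `A` by unimodular row and column
transformations, is diagonal, and its diagonal entries form a divisibility chain. -/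
def IsSNF {R : Type*} [CommRing R] {b : ℕ} (A D : Matrix (Fin b) (Fin b) R) : Prop :=
  (∃ X Y : Matrix (Fin b) (Fin b) R, IsUnit X.det ∧ IsUnit Y.det ∧ X * A * Y = D)
  ∧ (∀ i j : Fin b, i ≠ j → D i j = 0)
  ∧ (∀ i j : Fin b, i ≤ j → D i i ∣ D j j)

theorem det_mem_of_block_mem {R : Type*} [CommRing R] {b : ℕ} (I : Ideal R)
    (M : Matrix (Fin b) (Fin b) R) (r c : Finset (Fin b)) (hcard : b < r.card + c.card)
    (h : ∀ i ∈ r, ∀ j ∈ c, M i j ∈ I) : M.det ∈ I := by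
  rw [Matrix.det_apply]
  refine Ideal.sum_mem _ fun σ _ => ?_
  have hint : ∃ j ∈ c, σ j ∈ r := by
    by_contra! hne
    have hdisj : Disjoint r (c.map σ.toEmbedding) := by
      rw [Finset.disjoint_left]
      intro x hx hx'
      obtain ⟨j, hj, rfl⟩ := Finset.mem_map.mp hx'
      exact hne j hj hx
    have hle := Finset.card_le_univ (r ∪ c.map σ.toEmbedding)
    rw [Finset.card_union_of_disjoint hdisj, Finset.card_map, Fintype.card_fin] at hle
    omega
  obtain ⟨j, hj, hσ⟩ := hint
  have hprod : ∏ i, M (σ i) i ∈ I :=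
    I.mem_of_dvd (Finset.dvd_prod_of_mem _ (Finset.mem_univ j)) (h _ hσ _ hj)
  rw [Units.smul_def, zsmul_eq_mul]
  exact I.mul_mem_left _ hprod

theorem card_eq_of_card_le_eq {ι : Type*} [Fintype ι] (s t : ι → ℕ)
    (h : ∀ k, (Finset.univ.filter fun i => k ≤ s i).card
      = (Finset.univ.filter fun i => k ≤ t i).card) (c : ℕ) :
    (Finset.univ.filter fun i => s i = c).card = (Finset.univ.filter fun i => t i = c).card := by
  classical
  have key : ∀ u : ι → ℕ, (Finset.univ.filter fun i => c ≤ u i).card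
      = (Finset.univ.filter fun i => u i = c).card
        + (Finset.univ.filter fun i => c + 1 ≤ u i).card := by
    intro u
    rw [← Finset.card_union_of_disjoint]
    · congr 1
      ext i
      simp only [Finset.mem_filter, Finset.mem_univ, true_and, Finset.mem_union]
      omega
    · rw [Finset.disjoint_filter]
      intro i _ hi
      omega
  have h1 := h c
  rw [key s, key t, h (c + 1)] at h1
  exact Nat.add_right_cancel h1

/-- A full-rank lattice containing `f ^ e • R ^ b` is, in suitable coordinates, the product of the
ideals generated by powers of `f`. -/
theorem exists_coordinates_of_pow_smul_mem {R : Type*} [CommRing R] [IsDomain R]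
    [IsPrincipalIdealRing R] {b : ℕ} {f : R} (hf : Prime f) (e : ℕ) (L : Submodule R (Fin b → R))
    (hL : ∀ v, f ^ e • v ∈ L) :
    ∃ (P Q : Matrix (Fin b) (Fin b) R) (s : Fin b → ℕ), P * Q = 1 ∧ Q * P = 1 ∧ Monotone s ∧
      (∀ i, s i ≤ e) ∧ ∀ v, v ∈ L ↔ ∀ i, f ^ s i ∣ (Q *ᵥ v) i := by
  have hinj : Function.Injective
      ((LinearMap.lsmul R (Fin b → R) (f ^ e)).codRestrict L hL) := by
    intro x y hxy
    have hxy' : f ^ e • x = f ^ e • y := congrArg Subtype.val hxy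
    exact smul_right_injective _ (pow_ne_zero e hf.ne_zero) hxy'
  have hrank : Module.finrank R L = Module.finrank R (Fin b → R) :=
    le_antisymm (Submodule.finrank_le L) (LinearMap.finrank_le_finrank_of_injective hinj)
  obtain ⟨β, a, γ, hγ⟩ := L.exists_smith_normal_form_of_rank_eq (Pi.basisFun R (Fin b)) hrank
  have hmem : ∀ v, v ∈ L ↔ ∀ i, a i ∣ β.repr v i := by
    intro v
    constructor
    · intro hv i
      have hsum : v = ∑ j, γ.repr ⟨v, hv⟩ j • (a j • β j) := by
        have := congrArg Subtype.val (γ.sum_repr ⟨v, hv⟩)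
        simpa only [Submodule.coe_sum, Submodule.coe_smul, hγ] using this.symm
      rw [hsum]
      simp only [map_sum, map_smul, Finsupp.coe_finsetSum, Finset.sum_apply, Finsupp.smul_apply,
        Module.Basis.repr_self, smul_eq_mul]
      rw [Finset.sum_eq_single i]
      · simp
      · intro j _ hj
        simp [hj]
      · simp
    · intro h
      rw [← β.sum_repr v]
      refine L.sum_mem fun i _ => ?_
      obtain ⟨c, hc⟩ := h i
      rw [hc, mul_comm, mul_smul, ← hγ]
      exact L.smul_mem _ (γ i).2
  have hdvd : ∀ i, a i ∣ f ^ e := by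
    intro i
    simpa using (hmem _).mp (hL (β i)) i
  choose t hte hta using fun i => (dvd_prime_pow hf e).mp (hdvd i)
  let σ := Tuple.sort t
  let δ := β.reindex σ.symm
  refine ⟨(Pi.basisFun R (Fin b)).toMatrix δ, δ.toMatrix (Pi.basisFun R (Fin b)), t ∘ σ,
    Module.Basis.toMatrix_mul_toMatrix_flip _ _, Module.Basis.toMatrix_mul_toMatrix_flip _ _,
    Tuple.monotone_sort t, fun i => hte _, fun v => ?_⟩
  have hrepr : δ.toMatrix (Pi.basisFun R (Fin b)) *ᵥ v = δ.repr v :=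
    Module.Basis.toMatrix_mulVec_repr (Pi.basisFun R (Fin b)) δ v
  rw [hrepr, hmem, ← σ.forall_congr_right]
  refine forall_congr' fun i => ?_
  rw [(hta _).dvd_iff_dvd_left]
  simp [δ]

theorem AdjoinRoot.mk_pow_dvd_mk_iff {R : Type*} [CommRing R] {f p : R[X]} {e a : ℕ}
    (ha : a ≤ e) : mk (f ^ e) (f ^ a) ∣ mk (f ^ e) p ↔ f ^ a ∣ p := by
  refine ⟨?_, map_dvd _⟩
  rintro ⟨q, hq⟩
  obtain ⟨q, rfl⟩ := mk_surjective q
  rw [← map_mul, mk_eq_mk] at hq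
  have h := dvd_add ((pow_dvd_pow f ha).trans hq) (dvd_mul_right (f ^ a) q)
  simpa using h

section PrimePower

variable {F : Type*} [Field F] {f : F[X]} {e b : ℕ}

theorem dvd_of_pow_dvd_mul_pow (hf : f ≠ 0) {p : F[X]} {a c : ℕ} (hca : c < a)
    (h : f ^ a ∣ p * f ^ c) : f ∣ p := by
  have h' : f * f ^ c ∣ p * f ^ c := by
    rw [← pow_succ']
    exact (pow_dvd_pow f hca).trans h
  exact (mul_dvd_mul_iff_right (pow_ne_zero c hf)).mp h'

theorem exists_associated_mk_pow (hf : Irreducible f) (x : AdjoinRoot (f ^ e)) :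
    ∃ i ≤ e, Associated x (AdjoinRoot.mk (f ^ e) (f ^ i)) := by
  obtain ⟨p, rfl⟩ := AdjoinRoot.mk_surjective x
  by_cases hp : f ^ e ∣ p
  · refine ⟨e, le_rfl, ?_⟩
    rw [AdjoinRoot.mk_eq_zero.mpr hp, AdjoinRoot.mk_self]
  · have hp0 : p ≠ 0 := by
      rintro rfl
      exact hp (dvd_zero _)
    obtain ⟨n, q, hq, hpq⟩ := WfDvdMonoid.max_power_factor hp0 hf
    have hn : n ≤ e := by
      by_contra! hlt
      exact hp (hpq ▸ (pow_dvd_pow f hlt.le).mul_right q)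
    refine ⟨n, hn, ?_⟩
    obtain ⟨u, v, huv⟩ : IsCoprime q (f ^ e) :=
      (((hf.coprime_iff_not_dvd).mpr hq).pow_left).symm
    have hunit : IsUnit (AdjoinRoot.mk (f ^ e) q) := by
      refine IsUnit.of_mul_eq_one (AdjoinRoot.mk (f ^ e) u) ?_
      have := congrArg (AdjoinRoot.mk (f ^ e)) huv
      simpa only [map_add, map_mul, AdjoinRoot.mk_self, mul_zero, add_zero, map_one,
        mul_comm _ (AdjoinRoot.mk (f ^ e) q)] using this
    rw [hpq, map_mul]
    exact associated_mul_unit_left _ _ hunit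

theorem eq_of_associated_mk_pow (hf : Irreducible f) {i j : ℕ} (hi : i ≤ e) (hj : j ≤ e)
    (h : Associated (AdjoinRoot.mk (f ^ e) (f ^ i)) (AdjoinRoot.mk (f ^ e) (f ^ j))) : i = j := by
  have h1 := (AdjoinRoot.mk_pow_dvd_mk_iff hi).mp h.dvd
  have h2 := (AdjoinRoot.mk_pow_dvd_mk_iff hj).mp h.symm.dvd
  rw [pow_dvd_pow_iff hf.ne_zero hf.not_isUnit] at h1 h2
  exact le_antisymm h1 h2

theorem card_le_of_mk_pow_dvd_mul (hf : Irreducible f) (he : 1 ≤ e)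
    (W : Matrix (Fin b) (Fin b) (AdjoinRoot (f ^ e))) (hW : IsUnit W.det) (s t : Fin b → ℕ)
    (hs : ∀ i, s i ≤ e)
    (h : ∀ i j, AdjoinRoot.mk (f ^ e) (f ^ s i) ∣ W i j * AdjoinRoot.mk (f ^ e) (f ^ t j))
    (k : ℕ) :
    (Finset.univ.filter fun i => k ≤ s i).card ≤ (Finset.univ.filter fun j => k ≤ t j).card := by
  by_contra! hlt
  have hcompl : (Finset.univ.filter fun j => k ≤ t j).card
      + (Finset.univ.filter fun j => ¬ k ≤ t j).card = b := by
    simpa using Finset.card_filter_add_card_filter_not (s := Finset.univ) fun j => k ≤ t j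
  have hmem : W.det ∈ Ideal.span {AdjoinRoot.mk (f ^ e) (f ^ 1)} := by
    refine det_mem_of_block_mem _ W (Finset.univ.filter fun i => k ≤ s i)
      (Finset.univ.filter fun j => ¬ k ≤ t j) (by omega) fun i hi j hj => ?_
    simp only [Finset.mem_filter, Finset.mem_univ, true_and, not_le] at hi hj
    obtain ⟨p, hp⟩ := AdjoinRoot.mk_surjective (W i j)
    have hij := h i j
    rw [← hp, ← map_mul, AdjoinRoot.mk_pow_dvd_mk_iff (hs i)] at hij
    rw [Ideal.mem_span_singleton, ← hp, pow_one]
    exact map_dvd _ (dvd_of_pow_dvd_mul_pow hf.ne_zero (by omega) hij)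
  have hone : AdjoinRoot.mk (f ^ e) (f ^ 1) ∣ AdjoinRoot.mk (f ^ e) 1 := by
    rw [map_one]
    exact (Ideal.mem_span_singleton.mp hmem).trans hW.dvd
  rw [AdjoinRoot.mk_pow_dvd_mk_iff he, pow_one] at hone
  exact hf.not_isUnit (isUnit_of_dvd_one hone)

/-- The lattice of polynomial vectors whose reductions are annihilated by `A`. -/
noncomputable def annihilatedLattice (A : Matrix (Fin b) (Fin b) (AdjoinRoot (f ^ e))) :
    Submodule F[X] (Fin b → F[X]) where
  carrier := {v | A *ᵥ (AdjoinRoot.mk (f ^ e) ∘ v) = 0}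
  zero_mem' := by
    have h : AdjoinRoot.mk (f ^ e) ∘ (0 : Fin b → F[X]) = 0 := by ext i; simp
    simp [h]
  add_mem' := by
    intro v w hv hw
    have h : AdjoinRoot.mk (f ^ e) ∘ (v + w)
        = AdjoinRoot.mk (f ^ e) ∘ v + AdjoinRoot.mk (f ^ e) ∘ w := by ext i; simp
    simp only [Set.mem_ofPred_eq] at hv hw ⊢
    rw [h, Matrix.mulVec_add, hv, hw, add_zero]
  smul_mem' := by
    intro c v hv
    have h : AdjoinRoot.mk (f ^ e) ∘ (c • v)
        = AdjoinRoot.mk (f ^ e) c • (AdjoinRoot.mk (f ^ e) ∘ v) := by ext i; simp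
    simp only [Set.mem_ofPred_eq] at hv ⊢
    rw [h, Matrix.mulVec_smul, hv, smul_zero]

theorem mem_annihilatedLattice {A : Matrix (Fin b) (Fin b) (AdjoinRoot (f ^ e))}
    {v : Fin b → F[X]} :
    v ∈ annihilatedLattice A ↔ A *ᵥ (AdjoinRoot.mk (f ^ e) ∘ v) = 0 := Iff.rfl

theorem pow_smul_mem_annihilatedLattice (A : Matrix (Fin b) (Fin b) (AdjoinRoot (f ^ e)))
    (v : Fin b → F[X]) : f ^ e • v ∈ annihilatedLattice A := by
  have h : AdjoinRoot.mk (f ^ e) ∘ (f ^ e • v) = 0 := by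
    ext i
    simp only [Function.comp_apply, Pi.smul_apply, smul_eq_mul, map_mul, AdjoinRoot.mk_self,
      zero_mul, Pi.zero_apply]
  rw [mem_annihilatedLattice, h, Matrix.mulVec_zero]

theorem mul_map_mk_eq_zero_iff {A : Matrix (Fin b) (Fin b) (AdjoinRoot (f ^ e))}
    {G : Matrix (Fin b) (Fin b) F[X]} :
    A * G.map (AdjoinRoot.mk (f ^ e)) = 0 ↔ ∀ j, G.col j ∈ annihilatedLattice A := by
  constructor
  · intro h j
    rw [mem_annihilatedLattice]
    ext i
    exact congrFun (congrFun h i) j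
  · intro h
    ext i j
    exact congrFun (mem_annihilatedLattice.mp (h j)) i

/-- A diagonal matrix describing the lattice of vectors annihilated by `A` is a Smith normal form
of every minimal generator of `A`. -/
theorem exists_mul_mul_eq_diagonal_of_minimal
    {A : Matrix (Fin b) (Fin b) (AdjoinRoot (f ^ e))} {P Q : Matrix (Fin b) (Fin b) F[X]}
    {s : Fin b → ℕ} (hPQ : P * Q = 1) (hQP : Q * P = 1)
    (hL : ∀ v, v ∈ annihilatedLattice A ↔ ∀ i, f ^ s i ∣ (Q *ᵥ v) i)
    {G : Matrix (Fin b) (Fin b) F[X]} (hgen : A * G.map (AdjoinRoot.mk (f ^ e)) = 0)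
    (hdet : G.det ≠ 0)
    (hmin : ∀ G' : Matrix (Fin b) (Fin b) F[X],
        (A * G'.map (AdjoinRoot.mk (f ^ e)) = 0 ∧ G'.det ≠ 0) →
        G.det.natDegree ≤ G'.det.natDegree) :
    ∃ X Y : Matrix (Fin b) (Fin b) F[X], IsUnit X.det ∧ IsUnit Y.det ∧
      X * G * Y = Matrix.diagonal fun i => f ^ s i := by
  have hcol : ∀ i j, f ^ s i ∣ (Q * G) i j := fun i j =>
    (hL _).mp (mul_map_mk_eq_zero_iff.mp hgen j) i
  choose U hU using hcol
  have hQG : Q * G = (Matrix.diagonal fun i => f ^ s i) * Matrix.of U := by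
    ext i j
    rw [Matrix.diagonal_mul, hU]
    rfl
  have hG : G = P * (Matrix.diagonal fun i => f ^ s i) * Matrix.of U := by
    rw [Matrix.mul_assoc, ← hQG, ← Matrix.mul_assoc, hPQ, Matrix.one_mul]
  have hdetG := congrArg Matrix.det hG
  rw [Matrix.det_mul] at hdetG
  have hH0 : (P * Matrix.diagonal fun i => f ^ s i).det ≠ 0 := by
    intro h
    rw [h, zero_mul] at hdetG
    exact hdet hdetG
  have hU0 : (Matrix.of U).det ≠ 0 := by
    intro h
    rw [h, mul_zero] at hdetG
    exact hdet hdetG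
  have hHgen : A * (P * Matrix.diagonal fun i => f ^ s i).map (AdjoinRoot.mk (f ^ e)) = 0 := by
    rw [mul_map_mk_eq_zero_iff]
    intro j
    rw [hL]
    intro i
    have h : (Q * (P * Matrix.diagonal fun i => f ^ s i)) i j
        = (Matrix.diagonal fun i => f ^ s i) i j := by
      rw [← Matrix.mul_assoc, hQP, Matrix.one_mul]
    change f ^ s i ∣ (Q * (P * Matrix.diagonal fun i => f ^ s i)) i j
    rw [h, Matrix.diagonal_apply]
    split_ifs <;> simp
  have hdeg := hmin _ ⟨hHgen, hH0⟩
  rw [hdetG, natDegree_mul hH0 hU0] at hdeg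
  have hUunit : IsUnit (Matrix.of U).det := by
    rw [isUnit_iff_degree_eq_zero, degree_eq_natDegree hU0]
    exact_mod_cast (by omega : (Matrix.of U).det.natDegree = 0)
  refine ⟨Q, (Matrix.of U)⁻¹, ?_, ?_, ?_⟩
  · exact IsUnit.of_mul_eq_one P.det (by rw [← Matrix.det_mul, hQP, Matrix.det_one])
  · exact Matrix.isUnit_nonsing_inv_det _ hUunit
  · rw [hQG, Matrix.mul_assoc, Matrix.mul_nonsing_inv _ hUunit, Matrix.mul_one]

theorem mulVec_eq_zero_iff_of_mem_annihilatedLattice_iff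
    {A : Matrix (Fin b) (Fin b) (AdjoinRoot (f ^ e))} {Q : Matrix (Fin b) (Fin b) F[X]}
    {s : Fin b → ℕ} (hs : ∀ i, s i ≤ e)
    (hL : ∀ v, v ∈ annihilatedLattice A ↔ ∀ i, f ^ s i ∣ (Q *ᵥ v) i)
    (x : Fin b → AdjoinRoot (f ^ e)) :
    A *ᵥ x = 0 ↔
      ∀ i, AdjoinRoot.mk (f ^ e) (f ^ s i) ∣ (Q.map (AdjoinRoot.mk (f ^ e)) *ᵥ x) i := by
  choose v hv using fun i => AdjoinRoot.mk_surjective (x i)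
  obtain rfl : AdjoinRoot.mk (f ^ e) ∘ v = x := funext hv
  rw [← mem_annihilatedLattice, hL]
  refine forall_congr' fun i => ?_
  rw [← RingHom.map_mulVec, AdjoinRoot.mk_pow_dvd_mk_iff (hs i)]

/-- The exponents of the lattice annihilated by `A` are complementary to those of the Smith normal
form of `A`. -/
theorem card_le_eq_of_mul_mul_eq (hf : Irreducible f) (he : 1 ≤ e)
    {A DA X Y : Matrix (Fin b) (Fin b) (AdjoinRoot (f ^ e))} (hX : IsUnit X.det)
    (hY : IsUnit Y.det) (hXY : X * A * Y = DA) (hdiag : ∀ i j, i ≠ j → DA i j = 0)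
    {t : Fin b → ℕ} (ht : ∀ j, t j ≤ e)
    (hDA : ∀ j, Associated (DA j j) (AdjoinRoot.mk (f ^ e) (f ^ t j)))
    {P Q : Matrix (Fin b) (Fin b) F[X]} {s : Fin b → ℕ} (hQP : Q * P = 1)
    (hs : ∀ i, s i ≤ e) (hL : ∀ v, v ∈ annihilatedLattice A ↔ ∀ i, f ^ s i ∣ (Q *ᵥ v) i)
    (k : ℕ) :
    (Finset.univ.filter fun i => k ≤ s i).card
      = (Finset.univ.filter fun i => k ≤ e - t i).card := by
  set φ := AdjoinRoot.mk (f ^ e) with hφ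
  have hker := mulVec_eq_zero_iff_of_mem_annihilatedLattice_iff hs hL
  have hQP' : Q.map φ * P.map φ = 1 := by
    rw [← Matrix.map_mul, hQP, Matrix.map_one _ (map_zero φ) (map_one φ)]
  have hdetQP : (Q.map φ).det * (P.map φ).det = 1 := by
    rw [← Matrix.det_mul, hQP', Matrix.det_one]
  have hkerA : ∀ z, A *ᵥ (Y *ᵥ z) = 0 ↔ DA *ᵥ z = 0 := by
    intro z
    have hz : DA *ᵥ z = X *ᵥ (A *ᵥ (Y *ᵥ z)) := by
      simp only [← hXY, Matrix.mulVec_mulVec, Matrix.mul_assoc]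
    rw [hz]
    refine ⟨fun h => by rw [h, Matrix.mulVec_zero], fun h => ?_⟩
    have h' := congrArg (X⁻¹ *ᵥ ·) h
    simpa [Matrix.mulVec_mulVec, ← Matrix.mul_assoc, Matrix.nonsing_inv_mul _ hX] using h'
  have hDAmul : ∀ z i, (DA *ᵥ z) i = DA i i * z i := by
    intro z i
    rw [Matrix.mulVec, dotProduct, Finset.sum_eq_single i]
    · intro j _ hj
      rw [hdiag i j hj.symm, zero_mul]
    · simp
  have hφe : φ (f ^ e) = 0 := AdjoinRoot.mk_self
  apply le_antisymm
  · refine card_le_of_mk_pow_dvd_mul hf he (Q.map φ * Y) ?_ s _ hs (fun i j => ?_) k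
    · rw [Matrix.det_mul]
      exact (IsUnit.of_mul_eq_one _ hdetQP).mul hY
    · have hz : DA *ᵥ Pi.single j (φ (f ^ (e - t j))) = 0 := by
        ext i
        rw [hDAmul, Pi.zero_apply]
        by_cases hij : i = j
        · subst hij
          rw [Pi.single_eq_same]
          obtain ⟨u, hu⟩ := (hDA i).symm
          rw [← hu, mul_right_comm, ← map_mul, ← pow_add, Nat.add_sub_cancel' (ht i), hφe,
            zero_mul]
        · rw [Pi.single_eq_of_ne hij, mul_zero]
      have h := (hker _).mp ((hkerA _).mpr hz) i
      rw [Matrix.mulVec_mulVec, Matrix.mulVec_single] at h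
      simpa using h
  · refine card_le_of_mk_pow_dvd_mul hf he (Y⁻¹ * P.map φ) ?_ _ s (fun i => Nat.sub_le _ _)
      (fun i j => ?_) k
    · rw [Matrix.det_mul]
      exact (Matrix.isUnit_nonsing_inv_det _ hY).mul
        (IsUnit.of_mul_eq_one_right _ hdetQP)
    · have hAz : A *ᵥ (P.map φ *ᵥ Pi.single j (φ (f ^ s j))) = 0 := by
        rw [hker]
        intro i
        rw [Matrix.mulVec_mulVec, hQP', Matrix.one_mulVec]
        by_cases hij : i = j
        · subst hij
          rw [Pi.single_eq_same]
        · rw [Pi.single_eq_of_ne hij]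
          exact dvd_zero _
      have hz : DA *ᵥ ((Y⁻¹ * P.map φ) *ᵥ Pi.single j (φ (f ^ s j))) = 0 := by
        rw [← hkerA, Matrix.mulVec_mulVec _ Y, ← Matrix.mul_assoc,
          Matrix.mul_nonsing_inv _ hY, Matrix.one_mul, hAz]
      have hzi := congrFun hz i
      rw [hDAmul, Pi.zero_apply, Matrix.mulVec_single] at hzi
      obtain ⟨u, hu⟩ := hDA i
      obtain ⟨p, hp⟩ := AdjoinRoot.mk_surjective ((Y⁻¹ * P.map φ) i j)
      have hzero : φ (f ^ t i * (p * f ^ s j)) = 0 := by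
        rw [map_mul, map_mul, ← hu, hφ, hp]
        simp only [Pi.smul_apply, Matrix.col_apply, MulOpposite.smul_eq_mul_unop,
          MulOpposite.unop_op] at hzi
        rw [mul_right_comm, hzi, zero_mul]
      rw [hφ, AdjoinRoot.mk_eq_zero] at hzero
      rw [← hp, ← map_mul]
      refine map_dvd _ ?_
      rw [← Nat.add_sub_cancel' (ht i), pow_add] at hzero
      exact (mul_dvd_mul_iff_left (pow_ne_zero _ hf.ne_zero)).mp hzero

end PrimePower

/-- If `A` over `F[x]/(f^e)` has Smith normal form with `m i` diagonal entries (associated to)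
`f^i` for `0 ≤ i ≤ e` (where `f^e = 0` in the quotient), then any minimal generator `G` of `A`
has Smith normal form over `F[x]` with exactly `m i` invariant factors (associated to)
`f^{e-i}`. -/
theorem stmt5 {F : Type*} [Field F] (f : F[X]) (hf : Irreducible f) (hmonic : f.Monic)
    (d : ℕ) (hd : f.natDegree = d) (e : ℕ) (he : 1 ≤ e) (b : ℕ)
    (A : Matrix (Fin b) (Fin b) (AdjoinRoot (f ^ e)))
    (m : Fin (e + 1) → ℕ) (hm : ∑ i, m i = b)
    (hA : ∃ DA : Matrix (Fin b) (Fin b) (AdjoinRoot (f ^ e)), IsSNF A DA ∧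
        ∀ i : Fin (e + 1),
          Nat.card {j : Fin b // Associated (DA j j) (AdjoinRoot.mk (f ^ e) (f ^ (i : ℕ)))} = m i)
    (G : Matrix (Fin b) (Fin b) F[X])
    (hgen : A * G.map (AdjoinRoot.mk (f ^ e)) = 0) (hdet : G.det ≠ 0)
    (hmin : ∀ G' : Matrix (Fin b) (Fin b) F[X],
        (A * G'.map (AdjoinRoot.mk (f ^ e)) = 0 ∧ G'.det ≠ 0) →
        G.det.natDegree ≤ G'.det.natDegree) :
    ∃ D : Matrix (Fin b) (Fin b) F[X], IsSNF G D ∧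
      ∀ i : Fin (e + 1),
        Nat.card {j : Fin b // Associated (D j j) (f ^ (e - (i : ℕ)))} = m i := by
  obtain ⟨DA, ⟨⟨X, Y, hX, hY, hXY⟩, hdiag, -⟩, hcount⟩ := hA
  choose t ht hDA using fun j => exists_associated_mk_pow (e := e) hf (DA j j)
  obtain ⟨P, Q, s, hPQ, hQP, hmono, hs, hL⟩ :=
    exists_coordinates_of_pow_smul_mem hf.prime e _ (pow_smul_mem_annihilatedLattice A)
  refine ⟨Matrix.diagonal fun i => f ^ s i,
    ⟨exists_mul_mul_eq_diagonal_of_minimal hPQ hQP hL hgen hdet hmin,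
      fun i j hij => Matrix.diagonal_apply_ne _ hij, fun i j hij => ?_⟩, fun i => ?_⟩
  · simpa using pow_dvd_pow f (hmono hij)
  · have hi : (i : ℕ) ≤ e := Nat.lt_succ_iff.mp i.2
    have hcard := card_eq_of_card_le_eq s (fun j => e - t j)
      (card_le_eq_of_mul_mul_eq hf he hX hY hXY hdiag ht hDA hQP hs hL) (e - i)
    classical
    rw [← hcount i, Nat.card_eq_fintype_card, Nat.card_eq_fintype_card, Fintype.card_subtype,
      Fintype.card_subtype]
    convert hcard using 2
    · ext j
      simp only [Finset.mem_filter, Finset.mem_univ, true_and, Matrix.diagonal_apply_eq]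
      refine ⟨fun h => ?_, fun h => h ▸ Associated.refl _⟩
      exact (pow_injective_of_not_isUnit hf.not_isUnit hf.ne_zero)
        (eq_of_monic_of_associated (hmonic.pow _) (hmonic.pow _) h)
    · ext j
      simp only [Finset.mem_filter, Finset.mem_univ, true_and]
      have hiff : e - t j = e - i ↔ t j = i := by
        have := ht j
        omega
      rw [hiff]
      exact ⟨fun h => eq_of_associated_mk_pow hf (ht j) hi ((hDA j).symm.trans h),
        fun h => h ▸ hDA j⟩
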